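/- Suppose the two items are i.i.d.: [x_A,x_B] = [y_A,y_C] and f₁ = f₂ = h, and PR(h)(x) ≤ −3/2 for all x ∈ [x_A,x_B]. Then bundling sale is optimal: the supremum over feasible utility functions u of R(u) equals BRev. -/

import Mathlib

open MeasureTheory Set

noncomputable section

/-- A positive, bounded, differentiable density on `[a,b]` integrating to 1. -/
def Density (a b : ℝ) (h : ℝ → ℝ) : Prop :=
  (∀ x ∈ Set.Icc a b, 0 < h x) ∧ (∃ M, ∀ x ∈ Set.Icc a b, h x ≤ M) ∧
  (∀ x ∈ Set.Icc a b, DifferentiableAt ℝ h x) ∧ (∫ x in a..b, h x) = 1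

/-- The valuation rectangle `V = [xA,xB] × [yA,yC]`. -/
def V (xA xB yA yC : ℝ) : Set (ℝ × ℝ) := Set.Icc (xA, yA) (xB, yC)

/-- First partial derivative. -/
def pd1 (u : ℝ × ℝ → ℝ) (z : ℝ × ℝ) : ℝ := fderiv ℝ u z (1, 0)

/-- Second partial derivative. -/
def pd2 (u : ℝ × ℝ → ℝ) (z : ℝ × ℝ) : ℝ := fderiv ℝ u z (0, 1)

/-- A feasible buyer utility function: nonnegative, convex, with increments in each
coordinate between `0` and the coordinate increment (partial derivatives in `[0,1]`). -/
def Feasible (xA xB yA yC : ℝ) (u : ℝ × ℝ → ℝ) : Prop :=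
  (∀ z ∈ V xA xB yA yC, 0 ≤ u z) ∧
  ConvexOn ℝ (V xA xB yA yC) u ∧
  (∀ x x' y, xA ≤ x → x ≤ x' → x' ≤ xB → y ∈ Set.Icc yA yC →
    0 ≤ u (x', y) - u (x, y) ∧ u (x', y) - u (x, y) ≤ x' - x) ∧
  (∀ x y y', x ∈ Set.Icc xA xB → yA ≤ y → y ≤ y' → y' ≤ yC →
    0 ≤ u (x, y') - u (x, y) ∧ u (x, y') - u (x, y) ≤ y' - y)

/-- The seller's expected revenue from utility function `u` under joint density
`f₁(x)·f₂(y)`. -/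
def Rev (xA xB yA yC : ℝ) (f1 f2 : ℝ → ℝ) (u : ℝ × ℝ → ℝ) : ℝ :=
  ∫ z in V xA xB yA yC, (z.1 * pd1 u z + z.2 * pd2 u z - u z) * (f1 z.1 * f2 z.2)

/-- The optimal revenue: supremum of revenue over feasible utility functions. -/
def OptRev (xA xB yA yC : ℝ) (f1 f2 : ℝ → ℝ) : ℝ :=
  sSup {r | ∃ u, Feasible xA xB yA yC u ∧ r = Rev xA xB yA yC f1 f2 u}

/-- A feasible utility function is optimal if its revenue attains the supremum. -/
def Optimal (xA xB yA yC : ℝ) (f1 f2 : ℝ → ℝ) (u : ℝ × ℝ → ℝ) : Prop :=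
  Feasible xA xB yA yC u ∧ Rev xA xB yA yC f1 f2 u = OptRev xA xB yA yC f1 f2

/-- The power rate of a density `h`: `PR(h)(x) = x·h'(x)/h(x)`. -/
def PR (h : ℝ → ℝ) (x : ℝ) : ℝ := x * deriv h x / h x

/-- The bundling revenue `BRev = sup_{p ≥ 0} p · ∫_{x+y ≥ p} f`. -/
def BRev (xA xB yA yC : ℝ) (f1 f2 : ℝ → ℝ) : ℝ :=
  sSup {r | ∃ p, 0 ≤ p ∧
    r = p * ∫ z in {z ∈ V xA xB yA yC | p ≤ z.1 + z.2}, f1 z.1 * f2 z.2}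

/-- The payment associated with utility `u` at a point of differentiability. -/
def pay (u : ℝ × ℝ → ℝ) (z : ℝ × ℝ) : ℝ := pd1 u z * z.1 + pd2 u z * z.2 - u z

/-! ### Feasible functions -/

lemma mem_V {a b : ℝ} {z : ℝ × ℝ} :
    z ∈ V a b a b ↔ (a ≤ z.1 ∧ z.1 ≤ b) ∧ (a ≤ z.2 ∧ z.2 ≤ b) := by
  simp only [V, mem_Icc, Prod.le_def]
  tauto

lemma V_eq_prod (a b : ℝ) : V a b a b = Icc a b ×ˢ Icc a b := by
  simp [V]

lemma isCompact_V (a b : ℝ) : IsCompact (V a b a b) := isCompact_Icc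

lemma measurableSet_V (a b : ℝ) : MeasurableSet (V a b a b) := measurableSet_Icc

lemma convex_V (a b : ℝ) : Convex ℝ (V a b a b) := convex_Icc _ _

lemma lipschitzOnWith_of_increments {a b : ℝ} {u : ℝ × ℝ → ℝ} (hu : Feasible a b a b u) :
    LipschitzOnWith 2 u (V a b a b) := by
  obtain ⟨-, -, h1, h2⟩ := hu
  have e1 : ∀ x x' y, x ∈ Icc a b → x' ∈ Icc a b → y ∈ Icc a b →
      |u (x, y) - u (x', y)| ≤ |x - x'| := by
    intro x x' y hx hx' hy
    rcases le_total x x' with hle | hle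
    · have := h1 x x' y hx.1 hle hx'.2 hy
      rw [abs_sub_comm, abs_sub_comm x, abs_of_nonneg this.1, abs_of_nonneg (by linarith)]
      exact this.2
    · have := h1 x' x y hx'.1 hle hx.2 hy
      rw [abs_of_nonneg this.1, abs_of_nonneg (by linarith)]
      exact this.2
  have e2 : ∀ x y y', x ∈ Icc a b → y ∈ Icc a b → y' ∈ Icc a b →
      |u (x, y) - u (x, y')| ≤ |y - y'| := by
    intro x y y' hx hy hy'
    rcases le_total y y' with hle | hle
    · have := h2 x y y' hx hy.1 hle hy'.2
      rw [abs_sub_comm, abs_sub_comm y, abs_of_nonneg this.1, abs_of_nonneg (by linarith)]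
      exact this.2
    · have := h2 x y' y hx hy'.1 hle hy.2
      rw [abs_of_nonneg this.1, abs_of_nonneg (by linarith)]
      exact this.2
  refine LipschitzOnWith.of_dist_le_mul ?_
  rintro ⟨x, y⟩ hz ⟨x', y'⟩ hz'
  rw [mem_V] at hz hz'
  have k1 := e1 x x' y hz.1 hz'.1 hz.2
  have k2 := e2 x' y y' hz'.1 hz.2 hz'.2
  have k3 := abs_sub_le (u (x, y)) (u (x', y)) (u (x', y'))
  rw [Prod.dist_eq, Real.dist_eq]
  simp only [Real.dist_eq]
  have m1 := le_max_left |x - x'| |y - y'|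
  have m2 := le_max_right |x - x'| |y - y'|
  push_cast
  linarith

lemma ae_V_mem_nhds (a b : ℝ) :
    ∀ᵐ z ∂(volume.restrict (V a b a b)), V a b a b ∈ nhds z := by
  have h0 : volume (frontier (V a b a b)) = 0 := (convex_V a b).addHaar_frontier volume
  have h1 : ∀ᵐ z : ℝ × ℝ, z ∉ frontier (V a b a b) := by
    rw [ae_iff]; simpa using h0
  filter_upwards [ae_restrict_of_ae h1, ae_restrict_mem (measurableSet_V a b)] with z hz hzV
  rw [← mem_interior_iff_mem_nhds]
  by_contra hn
  exact hz ⟨subset_closure hzV, hn⟩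

lemma mem_Ioo_of_V_mem_nhds {a b : ℝ} {z : ℝ × ℝ} (hz : V a b a b ∈ nhds z) :
    z.1 ∈ Ioo a b ∧ z.2 ∈ Ioo a b := by
  rw [V_eq_prod, ← mem_interior_iff_mem_nhds, interior_prod_eq, interior_Icc] at hz
  exact hz

lemma ae_differentiableAt {a b : ℝ} {u : ℝ × ℝ → ℝ} (hu : Feasible a b a b u) :
    ∀ᵐ z ∂(volume.restrict (V a b a b)), DifferentiableAt ℝ u z := by
  filter_upwards [ae_V_mem_nhds a b,
    (lipschitzOnWith_of_increments hu).ae_differentiableWithinAt (μ := volume) (measurableSet_V a b)]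
    with z hz hd
  exact hd.differentiableAt hz

lemma continuousOn_of_feasible {a b : ℝ} {u : ℝ × ℝ → ℝ} (hu : Feasible a b a b u) :
    ContinuousOn u (V a b a b) := (lipschitzOnWith_of_increments hu).continuousOn

lemma volume_V_lt_top (a b : ℝ) : volume (V a b a b) < ⊤ := (isCompact_V a b).measure_lt_top

lemma integrableOn_fderiv_apply {a b : ℝ} {u : ℝ × ℝ → ℝ} (hu : Feasible a b a b u)
    (v : ℝ × ℝ) : IntegrableOn (fun z => fderiv ℝ u z v) (V a b a b) := by
  refine Measure.integrableOn_of_bounded (M := 2 * ‖v‖) (volume_V_lt_top a b).ne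
    (measurable_fderiv_apply_const ℝ u v).aestronglyMeasurable ?_
  filter_upwards [ae_V_mem_nhds a b] with z hz
  refine (ContinuousLinearMap.le_opNorm _ _).trans ?_
  gcongr
  exact norm_fderiv_le_of_lipschitzOn ℝ hz (lipschitzOnWith_of_increments hu)

lemma continuousOn_density {a b : ℝ} {h : ℝ → ℝ} (hh : Density a b h) :
    ContinuousOn h (Icc a b) :=
  fun x hx => (hh.2.2.1 x hx).continuousAt.continuousWithinAt

lemma continuousOn_joint {a b : ℝ} {h : ℝ → ℝ} (hh : Density a b h) :
    ContinuousOn (fun z : ℝ × ℝ => h z.1 * h z.2) (V a b a b) := by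
  rw [V_eq_prod]
  have hc := continuousOn_density hh
  exact (hc.comp continuousOn_fst fun z hz => hz.1).mul
    (hc.comp continuousOn_snd fun z hz => hz.2)

/-- Half of the revenue of a symmetric utility function: the part of the revenue coming from
the second item. -/
def halfRev (a b : ℝ) (h : ℝ → ℝ) (u : ℝ × ℝ → ℝ) : ℝ :=
  ∫ z in V a b a b, (z.2 * pd2 u z - u z / 2) * (h z.1 * h z.2)

lemma integrableOn_halfRev {a b : ℝ} {h : ℝ → ℝ} (hh : Density a b h) {u : ℝ × ℝ → ℝ}
    (hu : Feasible a b a b u) :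
    IntegrableOn (fun z => (z.2 * pd2 u z - u z / 2) * (h z.1 * h z.2)) (V a b a b) := by
  have i1 : IntegrableOn (fun z => z.2 * pd2 u z) (V a b a b) :=
    (integrableOn_fderiv_apply hu (0, 1)).continuousOn_mul continuousOn_snd (isCompact_V a b)
  have i2 : IntegrableOn u (V a b a b) :=
    (continuousOn_of_feasible hu).integrableOn_compact (isCompact_V a b)
  exact (i1.sub (i2.div_const 2)).mul_continuousOn (continuousOn_joint hh) (isCompact_V a b)

lemma pd2_comp_swap (u : ℝ × ℝ → ℝ) (z : ℝ × ℝ) :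
    pd2 (u ∘ Prod.swap) z = pd1 u z.swap := by
  have := (ContinuousLinearEquiv.prodComm ℝ ℝ ℝ).comp_right_fderiv (f := u) (x := z)
  have e : (u ∘ Prod.swap) = u ∘ (ContinuousLinearEquiv.prodComm ℝ ℝ ℝ) := rfl
  unfold pd2 pd1
  rw [e, this]
  simp

lemma feasible_comp_swap {a b : ℝ} {u : ℝ × ℝ → ℝ} (hu : Feasible a b a b u) :
    Feasible a b a b (u ∘ Prod.swap) := by
  obtain ⟨h0, hc, h1, h2⟩ := hu
  refine ⟨fun z hz => h0 _ ?_, ?_, fun x x' y hx hxx hx' hy => h2 y x x' hy hx hxx hx',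
    fun x y y' hx hy hyy hy' => h1 y y' x hy hyy hy' hx⟩
  · rw [mem_V] at *
    exact hz.symm
  · refine (hc.comp_linearMap
      (ContinuousLinearEquiv.prodComm ℝ ℝ ℝ).toContinuousLinearMap.toLinearMap).subset
      (fun z hz => ?_) (convex_V a b)
    change z.swap ∈ V a b a b
    rw [mem_V] at *
    exact hz.symm

lemma setIntegral_V_swap {a b : ℝ} (f : ℝ × ℝ → ℝ) :
    ∫ z in V a b a b, f z.swap = ∫ z in V a b a b, f z := by
  rw [V_eq_prod]
  exact setIntegral_prod_swap (Icc a b) (Icc a b) f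

lemma rev_eq_halfRev_add {a b : ℝ} {h : ℝ → ℝ} (hh : Density a b h) {u : ℝ × ℝ → ℝ}
    (hu : Feasible a b a b u) :
    Rev a b a b h h u = halfRev a b h u + halfRev a b h (u ∘ Prod.swap) := by
  unfold halfRev
  rw [← setIntegral_V_swap (fun z => (z.2 * pd2 (u ∘ Prod.swap) z - (u ∘ Prod.swap) z / 2) * _),
    ← integral_add]
  · unfold Rev
    congr 1
    ext z
    simp only [pd2_comp_swap, Function.comp, Prod.swap_swap, Prod.fst_swap, Prod.snd_swap]
    ring
  · exact integrableOn_halfRev hh hu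
  · have := integrableOn_halfRev hh (feasible_comp_swap hu)
    rw [V_eq_prod] at this ⊢
    exact this.swap

/-- The symmetrization of a utility function under exchange of the items. -/
def symmetrize (u : ℝ × ℝ → ℝ) (z : ℝ × ℝ) : ℝ := (u z + u z.swap) / 2

lemma symmetrize_eq (u : ℝ × ℝ → ℝ) :
    symmetrize u = (1 / 2 : ℝ) • (u + u ∘ Prod.swap) := by
  ext z
  simp [symmetrize]
  ring

lemma feasible_symmetrize {a b : ℝ} {u : ℝ × ℝ → ℝ} (hu : Feasible a b a b u) :
    Feasible a b a b (symmetrize u) := by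
  obtain ⟨h0, hc, h1, h2⟩ := hu
  obtain ⟨g0, gc, g1, g2⟩ := feasible_comp_swap ⟨h0, hc, h1, h2⟩
  refine ⟨fun z hz => ?_, ?_, fun x x' y hx hxx hx' hy => ?_, fun x y y' hx hy hyy hy' => ?_⟩
  · have := h0 z hz
    have := g0 z hz
    simp only [Function.comp] at this
    unfold symmetrize
    positivity
  · rw [symmetrize_eq]
    exact (hc.add gc).smul (c := (1 / 2 : ℝ)) (by norm_num)
  · have k1 := h1 x x' y hx hxx hx' hy
    have k2 := g1 x x' y hx hxx hx' hy
    simp only [Function.comp] at k2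
    unfold symmetrize
    constructor <;> linarith
  · have k1 := h2 x y y' hx hy hyy hy'
    have k2 := g2 x y y' hx hy hyy hy'
    simp only [Function.comp] at k2
    unfold symmetrize
    constructor <;> linarith

lemma halfRev_symmetrize {a b : ℝ} {h : ℝ → ℝ} (hh : Density a b h) {u : ℝ × ℝ → ℝ}
    (hu : Feasible a b a b u) :
    2 * halfRev a b h (symmetrize u) = Rev a b a b h h u := by
  have hs := feasible_comp_swap hu
  rw [rev_eq_halfRev_add hh hu]
  unfold halfRev
  rw [← integral_add (integrableOn_halfRev hh hu) (integrableOn_halfRev hh hs),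
    ← integral_const_mul]
  refine integral_congr_ae ?_
  filter_upwards [ae_differentiableAt hu, ae_differentiableAt hs] with z h1 h2
  have e : fderiv ℝ (symmetrize u) z = (1 / 2 : ℝ) • (fderiv ℝ u z + fderiv ℝ (u ∘ Prod.swap) z) := by
    rw [symmetrize_eq]
    exact ((h1.hasFDerivAt.add h2.hasFDerivAt).const_smul (1 / 2 : ℝ)).fderiv
  have e2 : pd2 (symmetrize u) z = (pd2 u z + pd2 (u ∘ Prod.swap) z) / 2 := by
    unfold pd2
    rw [e]
    simp
    ring
  simp only [e2, symmetrize, Function.comp]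
  ring

/-! ### Monotonicity of the revenue under the power rate condition -/

lemma continuousOn_slice {a b x : ℝ} (hx : x ∈ Icc a b) {u : ℝ × ℝ → ℝ}
    (hu : Feasible a b a b u) : ContinuousOn (fun y => u (x, y)) (Icc a b) :=
  (continuousOn_of_feasible hu).comp (by fun_prop) fun y hy => mem_V.2 ⟨hx, hy⟩

lemma convexOn_slice {a b x : ℝ} (hx : x ∈ Icc a b) {u : ℝ × ℝ → ℝ}
    (hu : Feasible a b a b u) : ConvexOn ℝ (Icc a b) fun y => u (x, y) := by
  refine ⟨convex_Icc a b, fun y hy y' hy' s t hs ht hst => ?_⟩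
  have := hu.2.1.2 (mem_V.2 ⟨hx, hy⟩ : (x, y) ∈ V a b a b)
    (mem_V.2 ⟨hx, hy'⟩ : (x, y') ∈ V a b a b) hs ht hst
  have e : s • (x, y) + t • (x, y') = (x, s • y + t • y') := by
    ext
    · simp [← add_mul, hst]
    · simp
  rwa [e] at this

lemma deriv_mul_le_of_PR_le {h : ℝ → ℝ} {x : ℝ} (hx : 0 < h x) (hPR : PR h x ≤ -(3 / 2)) :
    x * deriv h x ≤ -(3 / 2) * h x := by
  unfold PR at hPR
  rwa [div_le_iff₀ hx] at hPR

/-- The one-dimensional form of the monotonicity of the revenue. -/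
lemma integral_slice_nonneg {a b : ℝ} (h0 : 0 ≤ a) (h1 : a < b) {h : ℝ → ℝ}
    (hh : Density a b h) (hPR : ∀ x ∈ Icc a b, PR h x ≤ -(3 / 2)) {φ r : ℝ → ℝ}
    (hφc : ContinuousOn φ (Icc a b)) (hφa : φ a = 0) (hφ0 : ∀ y ∈ Icc a b, 0 ≤ φ y)
    (hr : ∀ y ∈ Ioo a b, HasDerivWithinAt φ (r y) (Ioi y) y)
    (hint : IntegrableOn (fun y => (y * r y - φ y / 2) * h y) (Icc a b)) :
    0 ≤ ∫ y in Icc a b, (y * r y - φ y / 2) * h y := by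
  have key := intervalIntegral.sub_le_integral_of_hasDeriv_right_of_le h1.le
    (g := fun y => y * h y * φ y)
    (g' := fun y => (1 * h y + y * deriv h y) * φ y + y * h y * r y)
    ((continuousOn_id.mul (continuousOn_density hh)).mul hφc) ?_ hint ?_
  · rw [hφa, intervalIntegral.integral_of_le h1.le, ← integral_Icc_eq_integral_Ioc] at key
    have hb := hφ0 b ⟨h1.le, le_rfl⟩
    have hb' := hh.1 b ⟨h1.le, le_rfl⟩
    have : 0 ≤ b * h b * φ b := by
      have : 0 < b := h0.trans_lt h1
      positivity
    linarith
  · intro y hy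
    have hd := (hh.2.2.1 y ⟨hy.1.le, hy.2.le⟩).hasDerivAt
    exact ((hasDerivAt_id y).mul hd).hasDerivWithinAt.mul (hr y hy)
  · intro y hy
    have hy' : y ∈ Icc a b := ⟨hy.1.le, hy.2.le⟩
    have := mul_le_mul_of_nonneg_right (deriv_mul_le_of_PR_le (hh.1 y hy') (hPR y hy'))
      (hφ0 y hy')
    nlinarith

lemma hasDerivAt_slice {u : ℝ × ℝ → ℝ} {x y : ℝ} (hu : DifferentiableAt ℝ u (x, y)) :
    HasDerivAt (fun t => u (x, t)) (pd2 u (x, y)) y := by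
  have h1 : HasDerivAt (fun t : ℝ => (x, t)) ((0 : ℝ), (1 : ℝ)) y :=
    (hasDerivAt_const y x).prodMk (hasDerivAt_id y)
  exact hu.hasFDerivAt.comp_hasDerivAt y h1

/-- If two utility functions agree when the second item has its lowest value, the larger one
yields the larger contribution of the second item. -/
lemma halfRev_mono {a b : ℝ} (h0 : 0 ≤ a) (h1 : a < b) {h : ℝ → ℝ}
    (hh : Density a b h) (hPR : ∀ x ∈ Icc a b, PR h x ≤ -(3 / 2)) {u w : ℝ × ℝ → ℝ}
    (hu : Feasible a b a b u) (hw : Feasible a b a b w)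
    (huw : ∀ z ∈ V a b a b, u z ≤ w z) (hbot : ∀ x ∈ Icc a b, u (x, a) = w (x, a)) :
    halfRev a b h u ≤ halfRev a b h w := by
  rw [← sub_nonneg]
  unfold halfRev
  have iu := integrableOn_halfRev hh hu
  have iw := integrableOn_halfRev hh hw
  have hdu := ae_differentiableAt hu
  have hdw := ae_differentiableAt hw
  rw [← integral_sub iw iu]
  have isub : IntegrableOn (fun z => (z.2 * pd2 w z - w z / 2) * (h z.1 * h z.2) -
      (z.2 * pd2 u z - u z / 2) * (h z.1 * h z.2)) (V a b a b) := iw.sub iu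
  rw [V_eq_prod, Measure.volume_eq_prod] at isub hdu hdw ⊢
  rw [setIntegral_prod _ isub]
  rw [IntegrableOn, ← Measure.prod_restrict] at isub
  rw [← Measure.prod_restrict] at hdu hdw
  refine integral_nonneg_of_ae ?_
  filter_upwards [Measure.ae_ae_of_ae_prod hdu, Measure.ae_ae_of_ae_prod hdw, isub.prod_right_ae,
    ae_restrict_mem measurableSet_Icc] with x hux hwx hix hx
  have hpt : ∀ y ∈ Icc a b, (x, y) ∈ V a b a b := fun y hy => mem_V.2 ⟨hx, hy⟩
  set du := fun y => derivWithin (fun t => u (x, t)) (Ioi y) y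
  set dw := fun y => derivWithin (fun t => w (x, t)) (Ioi y) y
  have hcongr : (fun y => (y * (dw y - du y) - (w (x, y) - u (x, y)) / 2) * h y)
      =ᵐ[volume.restrict (Icc a b)] fun y => (h x)⁻¹ *
        ((y * pd2 w (x, y) - w (x, y) / 2) * (h x * h y) -
          (y * pd2 u (x, y) - u (x, y) / 2) * (h x * h y)) := by
    filter_upwards [hux, hwx] with y huy hwy
    have e1 : du y = pd2 u (x, y) :=
      (hasDerivAt_slice huy).hasDerivWithinAt.derivWithin (uniqueDiffWithinAt_Ioi y)
    have e2 : dw y = pd2 w (x, y) :=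
      (hasDerivAt_slice hwy).hasDerivWithinAt.derivWithin (uniqueDiffWithinAt_Ioi y)
    have hx0 := (hh.1 x hx).ne'
    rw [e1, e2]
    field_simp
    ring
  have hi : IntegrableOn (fun y => (y * (dw y - du y) - (w (x, y) - u (x, y)) / 2) * h y)
      (Icc a b) := (hix.const_mul (h x)⁻¹).congr hcongr.symm
  have hpos := integral_slice_nonneg h0 h1 hh hPR (φ := fun y => w (x, y) - u (x, y))
    ((continuousOn_slice hx hw).sub (continuousOn_slice hx hu))
    (by simp [hbot x hx]) (fun y hy => sub_nonneg.2 (huw _ (hpt y hy)))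
    (fun y hy => by
      rw [← interior_Icc] at hy
      exact ((convexOn_slice hx hw).hasDerivWithinAt_rightDeriv_of_mem_interior hy).sub
        ((convexOn_slice hx hu).hasDerivWithinAt_rightDeriv_of_mem_interior hy)) hi
  rw [integral_congr_ae hcongr, integral_const_mul] at hpos
  exact nonneg_of_mul_nonneg_right hpos (inv_pos.2 (hh.1 x hx))

/-! ### Utility functions of the bundle -/

/-- A utility function of the value of the bundle, on the interval `[c,d]`. -/
def BundleUtility (c d : ℝ) (w : ℝ → ℝ) : Prop :=
  (∀ s ∈ Icc c d, 0 ≤ w s) ∧ ConvexOn ℝ (Icc c d) w ∧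
  ∀ s t, c ≤ s → s ≤ t → t ≤ d → 0 ≤ w t - w s ∧ w t - w s ≤ t - s

lemma feasible_bundle {a b : ℝ} {w : ℝ → ℝ} (hw : BundleUtility (2 * a) (2 * b) w) :
    Feasible a b a b fun z => w (z.1 + z.2) := by
  obtain ⟨w0, wc, wi⟩ := hw
  refine ⟨fun z hz => ?_, ?_, fun x x' y hx hxx hx' hy => ?_, fun x y y' hx hy hyy hy' => ?_⟩
  · rw [mem_V] at hz
    exact w0 _ ⟨by linarith, by linarith⟩
  · refine (wc.comp_linearMap (LinearMap.fst ℝ ℝ ℝ + LinearMap.snd ℝ ℝ ℝ)).subset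
      (fun z hz => ?_) (convex_V a b)
    rw [mem_V] at hz
    change z.1 + z.2 ∈ Icc (2 * a) (2 * b)
    exact ⟨by linarith, by linarith⟩
  · have := wi (x + y) (x' + y) (by linarith [hy.1]) (by linarith) (by linarith [hy.2])
    simpa using this
  · have := wi (x + y) (x + y') (by linarith [hx.1]) (by linarith) (by linarith [hx.2])
    simpa using this

lemma exists_hasDerivAt_bundle {w : ℝ → ℝ} {z : ℝ × ℝ}
    (hw : DifferentiableAt ℝ (fun z : ℝ × ℝ => w (z.1 + z.2)) z) :
    ∃ ρ, HasDerivAt w ρ (z.1 + z.2) ∧ pd1 (fun z : ℝ × ℝ => w (z.1 + z.2)) z = ρ ∧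
      pd2 (fun z : ℝ × ℝ => w (z.1 + z.2)) z = ρ := by
  obtain ⟨x, y⟩ := z
  have h1 : HasDerivAt (fun s : ℝ => (s - y, y)) ((1 : ℝ), (0 : ℝ)) (x + y) :=
    ((hasDerivAt_id _).sub_const y).prodMk (hasDerivAt_const _ y)
  have h2 : HasDerivAt (fun s : ℝ => (x, s - x)) ((0 : ℝ), (1 : ℝ)) (x + y) :=
    (hasDerivAt_const _ x).prodMk ((hasDerivAt_id _).sub_const x)
  have d1 := HasFDerivAt.comp_hasDerivAt (x + y)
    (f := fun s : ℝ => (s - y, y)) (l := fun z : ℝ × ℝ => w (z.1 + z.2))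
    (by simpa using hw.hasFDerivAt) h1
  have d2 := HasFDerivAt.comp_hasDerivAt (x + y)
    (f := fun s : ℝ => (x, s - x)) (l := fun z : ℝ × ℝ => w (z.1 + z.2))
    (by simpa using hw.hasFDerivAt) h2
  have e1 : ((fun z : ℝ × ℝ => w (z.1 + z.2)) ∘ fun s : ℝ => (s - y, y)) = w := by
    ext s; simp
  have e2 : ((fun z : ℝ × ℝ => w (z.1 + z.2)) ∘ fun s : ℝ => (x, s - x)) = w := by
    ext s; simp
  rw [e1] at d1
  rw [e2] at d2
  exact ⟨_, d1, rfl, d2.unique d1⟩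

lemma add_mul_sub_le_of_hasDerivAt {c d : ℝ} {w : ℝ → ℝ} (hw : ConvexOn ℝ (Icc c d) w)
    {s t ρ : ℝ} (hs : s ∈ Icc c d) (ht : t ∈ Icc c d) (hd : HasDerivAt w ρ s) :
    w s + ρ * (t - s) ≤ w t := by
  rcases lt_trichotomy s t with h | h | h
  · have := hw.le_slope_of_hasDerivAt hs ht h hd
    rw [slope_def_field, le_div_iff₀ (by linarith)] at this
    linarith
  · simp [h]
  · have := hw.slope_le_of_hasDerivAt ht hs h hd
    rw [slope_def_field, div_le_iff₀ (by linarith)] at this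
    linarith

lemma continuousOn_bundleUtility {c d : ℝ} {w : ℝ → ℝ} (hw : BundleUtility c d w) :
    ContinuousOn w (Icc c d) := by
  refine LipschitzOnWith.continuousOn (K := 1) (LipschitzOnWith.of_le_add ?_)
  intro s hs t ht
  rw [Real.dist_eq]
  rcases le_total s t with h | h
  · have := hw.2.2 s t hs.1 h ht.2
    linarith [abs_nonneg (s - t)]
  · have := hw.2.2 t s ht.1 h hs.2
    linarith [le_abs_self (s - t)]

/-- The payment of a buyer with bundle value `s` is at most the average payment under a uniform
lottery over finitely many bundle prices, up to an arbitrarily small error. -/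
lemma exists_prices {c d : ℝ} (hc : 0 ≤ c) (hcd : c < d) {w : ℝ → ℝ}
    (hw : BundleUtility c d w) {N : ℕ} (hN : 0 < N) :
    ∃ p : ℕ → ℝ, (∀ k, p k ∈ Icc c d) ∧ ∀ s ∈ Ioo c d, ∀ ρ, HasDerivAt w ρ s →
      s * ρ - w s ≤ d / N + (∑ k ∈ Finset.range N, if p k ≤ s then p k else 0) / N := by
  have hmax : ∀ k : ℕ, ∃ p ∈ Icc c d, ∀ t ∈ Icc c d,
      (k : ℝ) / N * t - w t ≤ (k : ℝ) / N * p - w p := by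
    intro k
    obtain ⟨p, hp, hmax⟩ := isCompact_Icc.exists_isMaxOn (nonempty_Icc.2 hcd.le)
      ((continuousOn_const (c := (k : ℝ) / N)).mul continuousOn_id |>.sub
        (continuousOn_bundleUtility hw))
    exact ⟨p, hp, hmax⟩
  choose p hp hpmax using hmax
  have hN' : (0 : ℝ) < N := by exact_mod_cast hN
  have hp0 : ∀ k, 0 ≤ p k := fun k => hc.trans (hp k).1
  have hsum : ∀ j : ℕ, (j : ℝ) / N * p j - w (p j) ≤ (∑ k ∈ Finset.range (j + 1), p k) / N := by
    intro j
    induction j with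
    | zero =>
      have := hw.1 _ (hp 0)
      have : 0 ≤ p 0 / N := div_nonneg (hp0 0) hN'.le
      simp
      linarith
    | succ j ih =>
      have := hpmax j _ (hp (j + 1))
      rw [Finset.sum_range_succ, add_div]
      have e : ((j + 1 : ℕ) : ℝ) / N * p (j + 1) = (j : ℝ) / N * p (j + 1) + p (j + 1) / N := by
        push_cast
        ring
      rw [e]
      linarith
  refine ⟨p, hp, fun s hs ρ hρ => ?_⟩
  have hsI : s ∈ Icc c d := Ioo_subset_Icc_self hs
  have htan := fun t ht => add_mul_sub_le_of_hasDerivAt hw.2.1 hsI (t := t) ht hρ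
  have hρ1 : ρ ≤ 1 := by
    have h1 := htan d ⟨hcd.le, le_rfl⟩
    have h2 := (hw.2.2 s d hs.1.le hs.2.le le_rfl).2
    have h3 : ρ * (d - s) ≤ 1 * (d - s) := by linarith
    exact le_of_mul_le_mul_right h3 (sub_pos.2 hs.2)
  have hs0 : 0 ≤ s := hc.trans hs.1.le
  have hterm : ∀ k, 0 ≤ if p k ≤ s then p k else 0 := fun k => by
    split_ifs
    exacts [hp0 k, le_rfl]
  rcases le_or_gt ρ 0 with hρ0 | hρ0
  · have h1 : 0 ≤ d / N := div_nonneg (hc.trans hcd.le) hN'.le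
    have h2 : 0 ≤ (∑ k ∈ Finset.range N, if p k ≤ s then p k else 0) / N :=
      div_nonneg (Finset.sum_nonneg fun k _ => hterm k) hN'.le
    have h3 := mul_nonpos_of_nonneg_of_nonpos hs0 hρ0
    have h4 := hw.1 s hsI
    linarith
  obtain ⟨j, hj⟩ : ∃ j, ⌈(N : ℝ) * ρ⌉₊ = j + 1 :=
    Nat.exists_eq_succ_of_ne_zero (Nat.ceil_pos.2 (by positivity)).ne'
  have hj1 : (j : ℝ) < N * ρ := Nat.lt_ceil.1 (by omega)
  have hj2 : N * ρ ≤ (j : ℝ) + 1 := by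
    have := Nat.le_ceil ((N : ℝ) * ρ)
    rw [hj] at this
    exact_mod_cast this
  have hjN : j + 1 ≤ N := by
    rw [← hj]
    refine Nat.ceil_le.2 ?_
    nlinarith
  have hle : ∀ k ∈ Finset.range (j + 1), p k ≤ s := by
    intro k hk
    have hkj : (k : ℝ) ≤ j := by exact_mod_cast Nat.lt_succ_iff.1 (Finset.mem_range.1 hk)
    have hlt : (k : ℝ) / N < ρ := by
      rw [div_lt_iff₀ hN']
      linarith
    have h1 := hpmax k s hsI
    have h2 := htan (p k) (hp k)
    by_contra! hn
    nlinarith [mul_pos (sub_pos.2 hlt) (sub_pos.2 hn)]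
  have h1 : s * ρ ≤ (j : ℝ) / N * s + d / N := by
    have : s * (N * ρ) ≤ j * s + d := by nlinarith [hs.2]
    have e : (j : ℝ) / N * s + d / N = (j * s + d) / N := by ring
    rw [e, le_div_iff₀ hN']
    linarith
  have h2 := (hpmax j s hsI).trans (hsum j)
  have h3 : (∑ k ∈ Finset.range (j + 1), p k) ≤
      ∑ k ∈ Finset.range N, if p k ≤ s then p k else 0 := by
    rw [← Finset.sum_congr rfl fun k hk => if_pos (hle k hk)]
    exact Finset.sum_le_sum_of_subset_of_nonneg (Finset.range_mono hjN) fun k _ _ => hterm k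
  have h4 := div_le_div_of_nonneg_right h3 hN'.le
  linarith

/-! ### Revenue of bundle utilities -/

lemma integrableOn_joint {a b : ℝ} {h : ℝ → ℝ} (hh : Density a b h) :
    IntegrableOn (fun z : ℝ × ℝ => h z.1 * h z.2) (V a b a b) :=
  (continuousOn_joint hh).integrableOn_compact (isCompact_V a b)

lemma joint_nonneg {a b : ℝ} {h : ℝ → ℝ} (hh : Density a b h) {z : ℝ × ℝ}
    (hz : z ∈ V a b a b) : 0 ≤ h z.1 * h z.2 := by
  rw [mem_V] at hz
  exact (mul_pos (hh.1 _ hz.1) (hh.1 _ hz.2)).le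

lemma integral_joint {a b : ℝ} (h1 : a < b) {h : ℝ → ℝ} (hh : Density a b h) :
    ∫ z in V a b a b, h z.1 * h z.2 = 1 := by
  have e := hh.2.2.2
  rw [intervalIntegral.integral_of_le h1.le, ← integral_Icc_eq_integral_Ioc] at e
  rw [V_eq_prod, Measure.volume_eq_prod, setIntegral_prod_mul h h, e, one_mul]

lemma measurableSet_price (p : ℝ) : MeasurableSet {z : ℝ × ℝ | p ≤ z.1 + z.2} :=
  measurableSet_le measurable_const (by fun_prop)

lemma setIntegral_price {a b : ℝ} (h : ℝ → ℝ) (p : ℝ) :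
    ∫ z in V a b a b, (if p ≤ z.1 + z.2 then p else 0) * (h z.1 * h z.2) =
      p * ∫ z in {z ∈ V a b a b | p ≤ z.1 + z.2}, h z.1 * h z.2 := by
  have e : {z ∈ V a b a b | p ≤ z.1 + z.2} = V a b a b ∩ {z | p ≤ z.1 + z.2} := rfl
  rw [e, ← integral_const_mul, ← setIntegral_indicator (measurableSet_price p)]
  congr 1
  ext z
  simp [indicator_apply]

lemma integrableOn_price {a b : ℝ} {h : ℝ → ℝ} (hh : Density a b h) (p : ℝ) :
    IntegrableOn (fun z : ℝ × ℝ => (if p ≤ z.1 + z.2 then p else 0) * (h z.1 * h z.2))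
      (V a b a b) := by
  refine (((integrableOn_joint hh).const_mul p).indicator (measurableSet_price p)).congr
    (Filter.Eventually.of_forall fun z => ?_)
  simp [indicator_apply]

lemma bddAbove_bundle {a b : ℝ} (h0 : 0 ≤ a) (h1 : a < b) {h : ℝ → ℝ} (hh : Density a b h) :
    BddAbove {r | ∃ p, 0 ≤ p ∧
      r = p * ∫ z in {z ∈ V a b a b | p ≤ z.1 + z.2}, h z.1 * h z.2} := by
  refine ⟨2 * b, ?_⟩
  rintro r ⟨p, hp, rfl⟩
  rw [← setIntegral_price]
  calc _ ≤ ∫ z in V a b a b, (2 * b) * (h z.1 * h z.2) := by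
        refine setIntegral_mono_on (integrableOn_price hh p)
          ((integrableOn_joint hh).const_mul _) (measurableSet_V a b) fun z hz => ?_
        refine mul_le_mul_of_nonneg_right ?_ (joint_nonneg hh hz)
        rw [mem_V] at hz
        split_ifs <;> linarith
    _ = 2 * b := by rw [integral_const_mul, integral_joint h1 hh, mul_one]

lemma price_le_BRev {a b : ℝ} (h0 : 0 ≤ a) (h1 : a < b) {h : ℝ → ℝ} (hh : Density a b h)
    {p : ℝ} (hp : 0 ≤ p) :
    p * ∫ z in {z ∈ V a b a b | p ≤ z.1 + z.2}, h z.1 * h z.2 ≤ BRev a b a b h h :=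
  le_csSup (bddAbove_bundle h0 h1 hh) ⟨p, hp, rfl⟩

lemma integrableOn_rev {a b : ℝ} {h : ℝ → ℝ} (hh : Density a b h) {u : ℝ × ℝ → ℝ}
    (hu : Feasible a b a b u) :
    IntegrableOn (fun z => (z.1 * pd1 u z + z.2 * pd2 u z - u z) * (h z.1 * h z.2))
      (V a b a b) := by
  have i1 : IntegrableOn (fun z => z.1 * pd1 u z) (V a b a b) :=
    (integrableOn_fderiv_apply hu (1, 0)).continuousOn_mul continuousOn_fst (isCompact_V a b)
  have i2 : IntegrableOn (fun z => z.2 * pd2 u z) (V a b a b) :=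
    (integrableOn_fderiv_apply hu (0, 1)).continuousOn_mul continuousOn_snd (isCompact_V a b)
  have i3 : IntegrableOn u (V a b a b) :=
    (continuousOn_of_feasible hu).integrableOn_compact (isCompact_V a b)
  exact ((i1.add i2).sub i3).mul_continuousOn (continuousOn_joint hh) (isCompact_V a b)

lemma rev_bundle_le_BRev {a b : ℝ} (h0 : 0 ≤ a) (h1 : a < b) {h : ℝ → ℝ} (hh : Density a b h)
    {w : ℝ → ℝ} (hw : BundleUtility (2 * a) (2 * b) w) :
    Rev a b a b h h (fun z => w (z.1 + z.2)) ≤ BRev a b a b h h := by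
  have hf := feasible_bundle hw
  have hN : ∀ n : ℕ, Rev a b a b h h (fun z => w (z.1 + z.2)) ≤
      2 * b / (n + 1) + BRev a b a b h h := by
    intro n
    obtain ⟨p, hp, hpay⟩ := exists_prices (by linarith) (by linarith) hw n.succ_pos
    have iS : IntegrableOn (fun z : ℝ × ℝ => ∑ k ∈ Finset.range (n + 1),
        (if p k ≤ z.1 + z.2 then p k else 0) * (h z.1 * h z.2)) (V a b a b) :=
      integrable_finsetSum _ fun k _ => integrableOn_price hh (p k)
    have hle : Rev a b a b h h (fun z => w (z.1 + z.2)) ≤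
        ∫ z in V a b a b, (2 * b / (n + 1) * (h z.1 * h z.2) +
          (∑ k ∈ Finset.range (n + 1), (if p k ≤ z.1 + z.2 then p k else 0) *
            (h z.1 * h z.2)) / (n + 1)) := by
      refine integral_mono_ae (integrableOn_rev hh hf)
        (((integrableOn_joint hh).const_mul _).add (iS.div_const _)) ?_
      filter_upwards [ae_V_mem_nhds a b, ae_differentiableAt hf,
        ae_restrict_mem (measurableSet_V a b)] with z hz hd hzV
      obtain ⟨ρ, hρ, e1, e2⟩ := exists_hasDerivAt_bundle hd
      obtain ⟨⟨k1, k2⟩, k3, k4⟩ := mem_Ioo_of_V_mem_nhds hz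
      have hs := hpay (z.1 + z.2) ⟨by linarith, by linarith⟩ ρ hρ
      have hm := mul_le_mul_of_nonneg_right hs (joint_nonneg hh hzV)
      simp only [e1, e2]
      rw [← Finset.sum_mul]
      push_cast at hm
      refine le_trans (le_of_eq (by ring)) (hm.trans (le_of_eq (by ring)))
    refine hle.trans ?_
    rw [integral_add ((integrableOn_joint hh).const_mul _) (iS.div_const _), integral_const_mul,
      integral_joint h1 hh, mul_one, integral_div,
      integral_finsetSum _ fun k _ => integrableOn_price hh (p k)]
    gcongr
    rw [div_le_iff₀ (by positivity)]
    calc _ ≤ ∑ _k ∈ Finset.range (n + 1), BRev a b a b h h := by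
          refine Finset.sum_le_sum fun k _ => ?_
          rw [setIntegral_price]
          exact price_le_BRev h0 h1 hh (by linarith [(hp k).1])
      _ = _ := by simp [mul_comm]
  have hlim : Filter.Tendsto (fun n : ℕ => 2 * b / ((n : ℝ) + 1) + BRev a b a b h h)
      Filter.atTop (nhds (0 + BRev a b a b h h)) := by
    refine Filter.Tendsto.add_const _ ?_
    simpa [div_eq_mul_inv] using
      (tendsto_one_div_add_atTop_nhds_zero_nat (𝕜 := ℝ)).const_mul (2 * b)
  rw [zero_add] at hlim
  exact ge_of_tendsto' hlim hN

lemma bundleUtility_price (c d p : ℝ) : BundleUtility c d fun s => max (s - p) 0 := by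
  refine ⟨fun s _ => le_max_right _ _, ?_, fun s t _ hst _ => ?_⟩
  · exact ((convexOn_id (convex_Icc c d)).add_const (-p)).sup (convexOn_const 0 (convex_Icc c d))
  · rcases max_cases (s - p) 0 with h | h <;> rcases max_cases (t - p) 0 with h' | h' <;>
      constructor <;> linarith

lemma rev_price {a b : ℝ} {h : ℝ → ℝ} (p : ℝ) :
    Rev a b a b h h (fun z => max (z.1 + z.2 - p) 0) =
      p * ∫ z in {z ∈ V a b a b | p ≤ z.1 + z.2}, h z.1 * h z.2 := by
  rw [← setIntegral_price]
  refine integral_congr_ae ?_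
  have hf : Feasible a b a b fun z => max (z.1 + z.2 - p) 0 :=
    feasible_bundle (bundleUtility_price _ _ p)
  filter_upwards [ae_differentiableAt hf] with z hz
  obtain ⟨ρ, hρ, e1, e2⟩ := exists_hasDerivAt_bundle (w := fun s => max (s - p) 0) hz
  have hlow : z.1 + z.2 ≤ p → ρ = 0 := fun hs => by
    refine IsLocalMin.hasDerivAt_eq_zero (Filter.Eventually.of_forall fun t => ?_) hρ
    simp [hs]
  have hhigh : p ≤ z.1 + z.2 → ρ - 1 = 0 := fun hs => by
    refine IsLocalMin.hasDerivAt_eq_zero (f := fun s => max (s - p) 0 - (s - p))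
      (Filter.Eventually.of_forall fun t => ?_) (hρ.sub ((hasDerivAt_id _).sub_const p))
    simp [hs]
  simp only [e1, e2]
  split_ifs with hs
  · rw [max_eq_left (by linarith), sub_eq_zero.1 (hhigh hs)]
    ring
  · rw [max_eq_right (by linarith), hlow (by linarith)]
    ring

/-! ### Comparison with a bundle utility -/

/-- Extending a utility function of the bundle with slope `1`. -/
lemma bundleUtility_extend {c m d : ℝ} (hcm : c ≤ m) {g : ℝ → ℝ}
    (hg : BundleUtility c m g) :
    BundleUtility c d fun s => if s ≤ m then g s else g m + (s - m) := by
  obtain ⟨g0, gc, gi⟩ := hg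
  have hm : m ∈ Icc c m := ⟨hcm, le_rfl⟩
  set w : ℝ → ℝ := fun s => if s ≤ m then g s else g m + (s - m)
  have wl : ∀ s, s ≤ m → w s = g s := fun s hs => if_pos hs
  have wr : ∀ s, m ≤ s → w s = g m + (s - m) := fun s hs => by
    rcases hs.eq_or_lt with rfl | hs
    · simp [w]
    · exact if_neg hs.not_ge
  have wi : ∀ s t, c ≤ s → s ≤ t → 0 ≤ w t - w s ∧ w t - w s ≤ t - s := by
    intro s t hs hst
    rcases le_total t m with ht | ht
    · rw [wl s (hst.trans ht), wl t ht]
      exact gi s t hs hst ht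
    · rcases le_total s m with hs' | hs'
      · have := gi s m hs hs' le_rfl
        rw [wl s hs', wr t ht]
        constructor <;> linarith
      · rw [wr s hs', wr t ht]
        constructor <;> linarith
  refine ⟨fun s hs => ?_, convexOn_of_slope_mono_adjacent (convex_Icc c d) ?_,
    fun s t hs hst _ => wi s t hs hst⟩
  · have h1 := g0 c ⟨le_rfl, hcm⟩
    have h2 := (wi c s le_rfl hs.1).1
    rw [wl c hcm] at h2
    linarith
  · intro x y z hx hz hxy hyz
    have hy : c ≤ y := hx.1.trans hxy.le
    rcases le_total z m with hzm | hzm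
    · rw [wl x (by linarith), wl y (by linarith), wl z hzm]
      exact gc.slope_mono_adjacent ⟨hx.1, by linarith⟩ ⟨hz.1, hzm⟩ hxy hyz
    have hone : (w y - w x) / (y - x) ≤ 1 := by
      rw [div_le_one (sub_pos.2 hxy)]
      exact (wi x y hx.1 hxy.le).2
    rw [le_div_iff₀ (sub_pos.2 hyz)]
    rcases le_or_gt m y with hym | hym
    · rw [wr z hzm, wr y hym] at *
      nlinarith
    · have h1 := gc.slope_mono_adjacent ⟨hx.1, by linarith⟩ hm hxy hym
      rw [le_div_iff₀ (sub_pos.2 hym), ← wl x (by linarith), ← wl y hym.le] at h1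
      rw [wr z hzm]
      nlinarith

lemma bundleUtility_left_edge {a b : ℝ} (h1 : a < b) {u : ℝ × ℝ → ℝ}
    (hu : Feasible a b a b u) : BundleUtility (2 * a) (a + b) fun s => u (a, s - a) := by
  have ha : a ∈ Icc a b := ⟨le_rfl, h1.le⟩
  refine ⟨fun s hs => hu.1 _ (mem_V.2 ⟨ha, ?_, ?_⟩), ?_, fun s t hs hst ht => ?_⟩
  · linarith [hs.1]
  · linarith [hs.2]
  · simp only [sub_eq_neg_add]
    exact ((convexOn_slice ha hu).translate_right (-a)).subset
      (fun s hs => ⟨by linarith [hs.1], by linarith [hs.2]⟩) (convex_Icc _ _)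
  · have := hu.2.2.2 a (s - a) (t - a) ha (by linarith) (by linarith) (by linarith)
    simpa using this

/-- A symmetric convex function increases along an antidiagonal away from the diagonal. -/
lemma le_of_antidiagonal {a b : ℝ} {u : ℝ × ℝ → ℝ} (hu : ConvexOn ℝ (V a b a b) u)
    (hsymm : ∀ x y, u (x, y) = u (y, x)) {x y p q : ℝ} (hp : p ∈ Icc a b) (hq : q ∈ Icc a b)
    (hs : x + y = p + q) (hpx : p ≤ x) (hpy : p ≤ y) : u (x, y) ≤ u (p, q) := by
  rcases (show p ≤ q by linarith).eq_or_lt with rfl | hpq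
  · rw [show x = p by linarith, show y = p by linarith]
  have hpq' : 0 < q - p := sub_pos.2 hpq
  have hsum : (y - p) / (q - p) + (x - p) / (q - p) = 1 := by
    field_simp
    linarith
  have := hu.2 (mem_V.2 ⟨hp, hq⟩ : (p, q) ∈ V a b a b) (mem_V.2 ⟨hq, hp⟩ : (q, p) ∈ V a b a b)
    (div_nonneg (by linarith) hpq'.le : 0 ≤ (y - p) / (q - p))
    (div_nonneg (by linarith) hpq'.le : 0 ≤ (x - p) / (q - p)) hsum
  have e : ((y - p) / (q - p)) • (p, q) + ((x - p) / (q - p)) • (q, p) = (x, y) := by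
    have hy : y = p + q - x := by linarith
    subst hy
    ext
    · simp
      field_simp
      ring
    · simp
      field_simp
      ring
  rwa [e, hsymm q p, smul_eq_mul, smul_eq_mul, ← add_mul, hsum, one_mul] at this

/-- A symmetric feasible utility function is dominated by a utility function of the bundle with
the same values on the lower edges. -/
lemma exists_bundle_dominating {a b : ℝ} (h1 : a < b) {u : ℝ × ℝ → ℝ}
    (hu : Feasible a b a b u) (hsymm : ∀ x y, u (x, y) = u (y, x)) :
    ∃ w, BundleUtility (2 * a) (2 * b) w ∧ (∀ z ∈ V a b a b, u z ≤ w (z.1 + z.2)) ∧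
      ∀ x ∈ Icc a b, u (x, a) = w (x + a) := by
  refine ⟨_, bundleUtility_extend (by linarith) (bundleUtility_left_edge h1 hu), ?_, ?_⟩
  · rintro ⟨x, y⟩ hz
    rw [mem_V] at hz
    obtain ⟨⟨hx1, hx2⟩, hy1, hy2⟩ := hz
    dsimp only at *
    split_ifs with hs
    · exact le_of_antidiagonal hu.2.1 hsymm ⟨le_rfl, h1.le⟩ ⟨by linarith, by linarith⟩
        (by ring) hx1 hy1
    · have k1 := le_of_antidiagonal hu.2.1 hsymm (x := x) (y := y) (p := x + y - b) (q := b)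
        ⟨by linarith, by linarith⟩ ⟨h1.le, le_rfl⟩ (by ring) (by linarith) (by linarith)
      have k2 := (hu.2.2.1 a (x + y - b) b le_rfl (by linarith) (by linarith)
        ⟨h1.le, le_rfl⟩).2
      rw [add_sub_cancel_left]
      linarith
  · intro x hx
    rw [if_pos (by linarith [hx.2]), hsymm, add_sub_cancel_right]

lemma rev_le_BRev {a b : ℝ} (h0 : 0 ≤ a) (h1 : a < b) {h : ℝ → ℝ} (hh : Density a b h)
    (hPR : ∀ x ∈ Icc a b, PR h x ≤ -(3 / 2)) {u : ℝ × ℝ → ℝ} (hu : Feasible a b a b u) :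
    Rev a b a b h h u ≤ BRev a b a b h h := by
  have hs := feasible_symmetrize hu
  obtain ⟨w, hw, hle, heq⟩ := exists_bundle_dominating h1 hs fun x y => by
    simp [symmetrize, add_comm]
  have hmono := halfRev_mono h0 h1 hh hPR hs (feasible_bundle hw) hle heq
  have hrev := halfRev_symmetrize hh (feasible_bundle hw)
  have e : symmetrize (fun z => w (z.1 + z.2)) = fun z => w (z.1 + z.2) := by
    ext z
    simp [symmetrize, add_comm z.2]
  rw [e] at hrev
  rw [← halfRev_symmetrize hh hu]
  linarith [rev_bundle_le_BRev h0 h1 hh hw]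

/-- for two i.i.d. items with density `h` satisfying `PR(h) ≤ −3/2`,
bundling sale is optimal: the optimal revenue equals the bundling revenue. -/
theorem stmt7 (a b : ℝ) (h0 : 0 ≤ a) (h1 : a < b)
    (h : ℝ → ℝ) (hh : Density a b h)
    (hPR : ∀ x ∈ Set.Icc a b, PR h x ≤ -(3/2)) :
    OptRev a b a b h h = BRev a b a b h h := by
  refine le_antisymm (csSup_le ⟨_, _, feasible_bundle (bundleUtility_price _ _ 0), rfl⟩ ?_)
    (csSup_le ⟨_, 0, le_rfl, rfl⟩ ?_)
  · rintro r ⟨u, hu, rfl⟩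
    exact rev_le_BRev h0 h1 hh hPR hu
  · rintro r ⟨p, -, rfl⟩
    refine le_csSup ⟨BRev a b a b h h, ?_⟩
      ⟨_, feasible_bundle (bundleUtility_price _ _ p), (rev_price p).symm⟩
    rintro r ⟨u, hu, rfl⟩
    exact rev_le_BRev h0 h1 hh hPR hu
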